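/- arXiv:math/0701318 — 3 statements merged into one kernel-verified Lean document; each statement's English description precedes it below -/
import Mathlib

section
/- Let N ≥ 1, n ≥ 1, let Σ be an N×N Hermitian positive-definite matrix, p ∈ {1,…,N} ∪ (N,∞), and let W be a random N×N Hermitian matrix with complex Wishart law W(Σ,p). For π ∈ S_n and matrices h_1,…,h_n ∈ M_{N×N}(ℂ), define r_π(h_1,…,h_n)(x) = ∏_{c ∈ C(π)} tr( ∏_{j ∈ c} x h_j ), the product inside each trace taken in the cyclic order of c. Then for every π_0 ∈ S_n, E( r_{π_0}(h_1,…,h_n)(W) ) = Σ_{π_1 ∈ S_n} p^{#C(π_1^{−1} π_0)} · r_{π_1}(h_1,…,h_n)(Σ). -/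
open MeasureTheory ProbabilityTheory Matrix Filter
open scoped ComplexOrder

noncomputable section

/-- The measurable space structure on complex matrices (entrywise/product σ-algebra). -/
instance matMS (N : ℕ) : MeasurableSpace (Matrix (Fin N) (Fin N) ℂ) :=
  inferInstanceAs (MeasurableSpace (Fin N → Fin N → ℂ))

/-- The set of minimal representatives of the cycles of a permutation. -/
def cycleReps {β : Type*} [Fintype β] [LinearOrder β] (π : Equiv.Perm β) : Finset β :=
  Finset.univ.filter fun j => ∀ i ∈ Finset.range (Fintype.card β), j ≤ (π ^ i) j

/-- The number of cycles of a permutation (fixed points count as cycles of length one). -/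
def cycleCount {β : Type*} [Fintype β] [LinearOrder β] (π : Equiv.Perm β) : ℕ :=
  (cycleReps π).card

/-- The product `f j * f (π j) * f (π² j) * ⋯` along the cycle of `π` containing `j`. -/
def cycleProd {β M : Type*} [Monoid M] (π : Equiv.Perm β) (f : β → M) (j : β) : M :=
  ((List.range (Function.minimalPeriod ⇑π j)).map fun i => f ((π ^ i) j)).prod

/-- `q_{σ,t,h}(x₁,…,x_s) = ∏_{c ∈ C(σ)} tr (∏_{j ∈ c} h(j) x_{t(j)})`, the product inside each
trace being taken in the order in which the elements appear along the cycle. -/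
def qMonomial {n N s : ℕ} (σ : Equiv.Perm (Fin n)) (t : Fin n → Fin s)
    (h : Fin n → Matrix (Fin N) (Fin N) ℂ) (x : Fin s → Matrix (Fin N) (Fin N) ℂ) : ℂ :=
  ∏ j ∈ cycleReps σ, (cycleProd σ (fun i => h i * x (t i)) j).trace

/-- `p ∈ {1,…,N} ∪ (N,∞)`. -/
def ShapeParam (N : ℕ) (p : ℝ) : Prop :=
  (∃ k : ℕ, 1 ≤ k ∧ k ≤ N ∧ p = k) ∨ (N : ℝ) < p

/-- `W` has the complex Wishart law with scale `S` and shape `p`: it is Hermitian valued and its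
Laplace transform is `det(I - θ S)^{-p}` for all Hermitian `θ` with `S⁻¹ - θ` positive definite. -/
def IsWishart {N : ℕ} {Ω : Type*} [MeasurableSpace Ω] (μ : Measure Ω)
    (W : Ω → Matrix (Fin N) (Fin N) ℂ) (S : Matrix (Fin N) (Fin N) ℂ) (p : ℝ) : Prop :=
  (∀ ω, (W ω).IsHermitian) ∧
    ∀ θ : Matrix (Fin N) (Fin N) ℂ, θ.IsHermitian → (S⁻¹ - θ).PosDef →
      ∫ ω, Complex.exp ((θ * W ω).trace) ∂μ = (1 - θ * S).det ^ (-(p : ℂ))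


/-- `r_π(h₁,…,h_n)(x) = ∏_{c ∈ C(π)} tr (∏_{j ∈ c} x h_j)`, products along cycles. -/
def rMonomial {n N : ℕ} (π : Equiv.Perm (Fin n)) (h : Fin n → Matrix (Fin N) (Fin N) ℂ)
    (x : Matrix (Fin N) (Fin N) ℂ) : ℂ :=
  ∏ j ∈ cycleReps π, (cycleProd π (fun i => x * h i) j).trace

lemma mem_cycleReps {β : Type*} [Fintype β] [LinearOrder β] (π : Equiv.Perm β) (j : β) :
    j ∈ cycleReps π ↔ ∀ k, π.SameCycle j k → j ≤ k := by
  simp only [cycleReps, Finset.mem_filter, Finset.mem_univ, true_and, Finset.mem_range]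
  constructor
  · intro h k hk
    by_cases hj : j ∈ π.support
    · obtain ⟨i, hi, rfl⟩ := hk.exists_pow_eq_of_mem_support hj
      exact h i (hi.trans_le (Finset.card_le_univ _))
    · rw [hk.eq_of_left (by simpa [Function.IsFixedPt] using hj)]
  · intro h i _
    exact h _ ⟨i, by simp⟩

lemma exists_mem_cycleReps {β : Type*} [Fintype β] [LinearOrder β] (π : Equiv.Perm β) (x : β) :
    ∃ j ∈ cycleReps π, π.SameCycle j x := by
  classical
  obtain ⟨j, hj, hmin⟩ := (Finset.univ.filter fun y => π.SameCycle x y).exists_min_image id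
    ⟨x, by simp [Equiv.Perm.SameCycle.refl]⟩
  simp only [Finset.mem_filter, Finset.mem_univ, true_and, id] at hj hmin
  exact ⟨j, (mem_cycleReps π j).2 fun k hk => hmin k (hj.trans hk), hj.symm⟩

lemma eq_of_mem_cycleReps {β : Type*} [Fintype β] [LinearOrder β] {π : Equiv.Perm β} {j k : β}
    (hj : j ∈ cycleReps π) (hk : k ∈ cycleReps π) (h : π.SameCycle j k) : j = k :=
  le_antisymm ((mem_cycleReps π j).1 hj k h) ((mem_cycleReps π k).1 hk j h.symm)

lemma cycleCount_eq_card_quotient {β : Type*} [Fintype β] [LinearOrder β] (π : Equiv.Perm β) :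
    cycleCount π = Nat.card (Quotient (Equiv.Perm.SameCycle.setoid π)) := by
  rw [cycleCount, ← Nat.card_eq_finsetCard]
  refine Nat.card_congr (Equiv.ofBijective
    (fun j : cycleReps π =>
      (Quotient.mk (Equiv.Perm.SameCycle.setoid π) j.1)) ⟨?_, ?_⟩)
  · intro j k h
    exact Subtype.ext (eq_of_mem_cycleReps j.2 k.2 (Quotient.exact h))
  · intro q
    induction q using Quotient.inductionOn with
    | h x =>
      obtain ⟨j, hj, h⟩ := exists_mem_cycleReps π x
      exact ⟨⟨j, hj⟩, Quotient.sound h⟩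

lemma cycleCount_conj {β : Type*} [Fintype β] [LinearOrder β] (g π : Equiv.Perm β) :
    cycleCount (g * π * g⁻¹) = cycleCount π := by
  rw [cycleCount_eq_card_quotient, cycleCount_eq_card_quotient]
  refine Nat.card_congr (Quotient.congr g⁻¹ fun x y => ?_)
  exact Equiv.Perm.sameCycle_conj

lemma apply_eq_of_sameCycle {β γ : Type*} {π : Equiv.Perm β} {f : β → γ}
    (hf : ∀ x, f (π x) = f x) {x y : β} (h : π.SameCycle x y) : f x = f y := by
  obtain ⟨i, rfl⟩ := h
  induction i using Int.induction_on with
  | zero => simp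
  | succ i ih => rw [add_comm, _root_.zpow_add, zpow_one, Equiv.Perm.mul_apply, hf, ih]
  | pred i ih =>
    rw [ih, sub_eq_neg_add, _root_.zpow_add, _root_.zpow_neg_one, Equiv.Perm.mul_apply,
      ← hf (π⁻¹ _)]
    simp

lemma cycleCount_decomposeFin_symm_zero {n : ℕ} (e : Equiv.Perm (Fin n)) :
    cycleCount (Equiv.Perm.decomposeFin.symm (0, e)) = cycleCount e + 1 := by
  rw [cycleCount_eq_card_quotient, cycleCount_eq_card_quotient, ← Finite.card_option]
  set π := Equiv.Perm.decomposeFin.symm (0, e) with hπ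
  have h0 : π 0 = 0 := by simp [hπ]
  have hs : ∀ x : Fin n, π x.succ = (e x).succ := fun x => by simp [hπ]
  let F : Fin (n + 1) → Option (Quotient (Equiv.Perm.SameCycle.setoid e)) :=
    Fin.cons none fun x => some (Quotient.mk _ x)
  have hF : ∀ x, F (π x) = F x := by
    intro x
    refine Fin.cases (by rw [h0]) (fun x => ?_) x
    rw [hs]
    simp only [F, Fin.cons_succ, Option.some.injEq]
    exact Quotient.sound (Equiv.Perm.sameCycle_apply_left.2 (Equiv.Perm.SameCycle.refl e x))
  let G : Fin n → Quotient (Equiv.Perm.SameCycle.setoid π) := fun x => Quotient.mk _ x.succ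
  have hG : ∀ x, G (e x) = G x := fun x => Quotient.sound (by
    rw [← hs]
    exact Equiv.Perm.sameCycle_apply_left.2 (Equiv.Perm.SameCycle.refl π _))
  exact Nat.card_congr
    { toFun := Quotient.lift F fun x y h => apply_eq_of_sameCycle hF h
      invFun := fun o => o.elim (Quotient.mk _ 0)
        (Quotient.lift G fun x y h => apply_eq_of_sameCycle hG h)
      left_inv := by
        intro q
        induction q using Quotient.inductionOn with
        | h x => refine Fin.cases ?_ (fun x => ?_) x <;> simp [F, G]
      right_inv := by
        rintro (_ | q)
        · simp [F]
        · induction q using Quotient.inductionOn with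
          | h x => simp [F, G] }

lemma cycleCount_decomposeFin_symm_succ {n : ℕ} (k : Fin n) (e : Equiv.Perm (Fin n)) :
    cycleCount (Equiv.Perm.decomposeFin.symm (k.succ, e)) = cycleCount e := by
  rw [cycleCount_eq_card_quotient, cycleCount_eq_card_quotient]
  set π := Equiv.Perm.decomposeFin.symm (k.succ, e) with hπ
  have h0 : π 0 = k.succ := by simp [hπ]
  have hs : ∀ x : Fin n, π x.succ = Equiv.swap 0 k.succ (e x).succ := fun x => by simp [hπ]
  have hs1 : ∀ x : Fin n, e x = k → π x.succ = 0 := fun x hx => by simp [hs, hx]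
  have hs2 : ∀ x : Fin n, e x ≠ k → π x.succ = (e x).succ := fun x hx => by
    rw [hs, Equiv.swap_apply_of_ne_of_ne (Fin.succ_ne_zero _) (by simpa using hx)]
  have hstep : ∀ x, π.SameCycle x (π x) := fun x =>
    Equiv.Perm.sameCycle_apply_right.2 (Equiv.Perm.SameCycle.refl π _)
  have estep : ∀ x, e.SameCycle (e x) x := fun x =>
    Equiv.Perm.sameCycle_apply_left.2 (Equiv.Perm.SameCycle.refl e _)
  let F : Fin (n + 1) → Quotient (Equiv.Perm.SameCycle.setoid e) :=
    Fin.cons (Quotient.mk _ k) fun x => Quotient.mk _ x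
  have hF : ∀ x, F (π x) = F x := by
    intro x
    refine Fin.cases (by rw [h0]; simp [F]) (fun x => ?_) x
    by_cases hx : e x = k
    · rw [hs1 x hx]
      simp only [F, Fin.cons_succ, Fin.cons_zero, ← hx]
      exact Quotient.sound (estep x)
    · rw [hs2 x hx]
      simp only [F, Fin.cons_succ]
      exact Quotient.sound (estep x)
  let G : Fin n → Quotient (Equiv.Perm.SameCycle.setoid π) := fun x => Quotient.mk _ x.succ
  have hG : ∀ x, G (e x) = G x := fun x => Quotient.sound (by
    by_cases hx : e x = k
    · have h1 := hstep x.succ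
      have h2 := hstep 0
      rw [hs1 x hx] at h1
      rw [h0] at h2
      rw [hx]
      exact (h1.trans h2).symm
    · rw [← hs2 x hx]
      exact (hstep _).symm)
  exact Nat.card_congr
    { toFun := Quotient.lift F fun x y h => apply_eq_of_sameCycle hF h
      invFun := Quotient.lift G fun x y h => apply_eq_of_sameCycle hG h
      left_inv := by
        intro q
        induction q using Quotient.inductionOn with
        | h x =>
          refine Fin.cases ?_ (fun x => ?_) x
          · have h2 := hstep 0
            rw [h0] at h2
            exact Quotient.sound h2.symm
          · simp [F, G]
      right_inv := by
        intro q
        induction q using Quotient.inductionOn with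
        | h x => simp [F, G] }

lemma list_prod_apply_eq_sum {ι R : Type*} [Fintype ι] [DecidableEq ι] [CommSemiring R] (k : ℕ)
    (A : ℕ → Matrix ι ι R) (u v : ι) :
    ((List.range (k + 1)).map A).prod u v =
      ∑ a : Fin k → ι, ∏ i : Fin (k + 1),
        A i ((Fin.cons u a : Fin (k + 1) → ι) i) ((Fin.snoc a v : Fin (k + 1) → ι) i) := by
  induction k generalizing A u with
  | zero => simp [Fin.snoc]
  | succ k ih =>
    rw [List.range_succ_eq_map, List.map_cons, List.prod_cons, List.map_map, Matrix.mul_apply,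
      ← (Fin.consEquiv fun _ => ι).sum_comp, Fintype.sum_prod_type]
    refine Finset.sum_congr rfl fun w _ => ?_
    rw [ih (A ∘ Nat.succ) w, Finset.mul_sum]
    refine Finset.sum_congr rfl fun a _ => ?_
    rw [Fin.prod_univ_succ (n := k + 1)]
    have hc : (Fin.consEquiv fun _ => ι) (w, a) = Fin.cons w a := rfl
    rw [hc, ← Fin.cons_snoc_eq_snoc_cons]
    simp only [Fin.cons_zero, Fin.cons_succ, Fin.val_zero, Fin.val_succ,
      Function.comp_apply, Nat.succ_eq_add_one]

lemma trace_list_prod_eq_sum {ι R : Type*} [Fintype ι] [DecidableEq ι] [CommSemiring R] {m : ℕ}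
    (hm : 0 < m) (A : ℕ → Matrix ι ι R) :
    ((List.range m).map A).prod.trace =
      ∑ a : Fin m → ι, ∏ i : Fin m, A i (a i) (a ⟨(i + 1) % m, Nat.mod_lt _ hm⟩) := by
  obtain ⟨k, rfl⟩ : ∃ k, m = k + 1 := ⟨m - 1, by omega⟩
  rw [Matrix.trace, ← (Fin.consEquiv fun _ => ι).sum_comp, Fintype.sum_prod_type]
  refine Finset.sum_congr rfl fun u _ => ?_
  rw [Matrix.diag_apply, list_prod_apply_eq_sum]
  refine Finset.sum_congr rfl fun a _ => Finset.prod_congr rfl fun i _ => ?_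
  congr 1
  refine Fin.lastCases ?_ (fun i => ?_) i
  · simp [Fin.consEquiv]
  · have : (⟨((i.castSucc : Fin (k + 1)) + 1 : ℕ) % (k + 1), Nat.mod_lt _ hm⟩ : Fin (k + 1))
        = i.succ := by
      ext
      simp [Nat.mod_eq_of_lt]
    rw [this]
    simp [Fin.consEquiv]

/-- Position `i` on the cycle whose minimal representative is `j`. -/
def cyclePoint {β : Type*} [Fintype β] [LinearOrder β] (π : Equiv.Perm β) :
    (Σ j : cycleReps π, Fin (Function.minimalPeriod π j.1)) → β :=
  fun x => (π ^ (x.2 : ℕ)) x.1.1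

lemma cyclePoint_bijective {β : Type*} [Fintype β] [LinearOrder β] (π : Equiv.Perm β) :
    Function.Bijective (cyclePoint π) := by
  constructor
  · rintro ⟨⟨j, hj⟩, i⟩ ⟨⟨k, hk⟩, l⟩ h
    simp only [cyclePoint] at h
    have hjk : j = k := by
      refine eq_of_mem_cycleReps hj hk ?_
      have h1 : π.SameCycle j ((π ^ (i : ℕ)) j) := ⟨i, by simp⟩
      have h2 : π.SameCycle k ((π ^ (l : ℕ)) k) := ⟨l, by simp⟩
      rw [h] at h1
      exact h1.trans h2.symm
    subst hjk
    have : (i : ℕ) = l := by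
      refine Function.iterate_injOn_Iio_minimalPeriod (f := π) (x := j) i.2 l.2 ?_
      simpa [Equiv.Perm.iterate_eq_pow] using h
    rw [Fin.ext this]
  · intro x
    obtain ⟨j, hj, h⟩ := exists_mem_cycleReps π x
    obtain ⟨i, -, hi⟩ := h.exists_pow_eq'
    have hpos : 0 < Function.minimalPeriod π j :=
      Function.minimalPeriod_pos_of_mem_periodicPts (π.injective.mem_periodicPts j)
    refine ⟨⟨⟨j, hj⟩, ⟨i % Function.minimalPeriod π j, Nat.mod_lt _ hpos⟩⟩, ?_⟩
    simp only [cyclePoint, ← hi, ← Equiv.Perm.iterate_eq_pow]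
    exact Function.iterate_mod_minimalPeriod_eq

lemma prod_trace_cycleProd {β ι : Type*} [Fintype β] [LinearOrder β] [Fintype ι] [DecidableEq ι]
    (π : Equiv.Perm β) (M : β → Matrix ι ι ℂ) :
    ∏ j ∈ cycleReps π, (cycleProd π M j).trace = ∑ a : β → ι, ∏ j, M j (a j) (a (π j)) := by
  have hpos : ∀ j, 0 < Function.minimalPeriod π j := fun j =>
    Function.minimalPeriod_pos_of_mem_periodicPts (π.injective.mem_periodicPts j)
  let E := Equiv.ofBijective _ (cyclePoint_bijective π)
  rw [← Finset.prod_coe_sort]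
  simp only [cycleProd]
  simp_rw [trace_list_prod_eq_sum (hpos _)]
  rw [Finset.prod_univ_sum, Fintype.piFinset_univ]
  refine Fintype.sum_equiv
    ((Equiv.piCurry fun _ _ => ι).symm.trans (E.arrowCongr (Equiv.refl ι))) _ _ fun a => ?_
  rw [← E.prod_comp, Fintype.prod_sigma]
  refine Finset.prod_congr rfl fun j _ => Finset.prod_congr rfl fun i _ => ?_
  have h1 : π (E ⟨j, i⟩) = E ⟨j, ⟨(i + 1) % Function.minimalPeriod π j,
      Nat.mod_lt _ (hpos _)⟩⟩ := by
    simp only [E, Equiv.ofBijective_apply, cyclePoint]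
    rw [← Equiv.Perm.mul_apply, ← pow_succ', ← Equiv.Perm.iterate_eq_pow,
      ← Equiv.Perm.iterate_eq_pow, Function.iterate_mod_minimalPeriod_eq]
  have h2 : ∀ x, ((Equiv.piCurry fun _ _ => ι).symm.trans (E.arrowCongr (Equiv.refl ι))) a (E x) =
      a x.1 x.2 := fun x => by
    change (fun z => a z.1 z.2) (E.symm (E x)) = _
    rw [E.symm_apply_apply]
  rw [h1, h2, h2]
  rfl

lemma rMonomial_eq_sum {n N : ℕ} (π : Equiv.Perm (Fin n)) (h : Fin n → Matrix (Fin N) (Fin N) ℂ)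
    (x : Matrix (Fin N) (Fin N) ℂ) :
    rMonomial π h x = ∑ a : Fin n → Fin N, ∑ b : Fin n → Fin N,
      (∏ j, h j (b j) (a (π j))) * ∏ j, x (a j) (b j) := by
  rw [rMonomial, prod_trace_cycleProd]
  refine Finset.sum_congr rfl fun a _ => ?_
  simp only [Matrix.mul_apply]
  rw [Finset.prod_univ_sum, Fintype.piFinset_univ]
  refine Finset.sum_congr rfl fun b _ => ?_
  rw [Finset.prod_mul_distrib, mul_comm]

lemma integrable_mul_and_hasDerivAt_integral_mul_exp {Ω : Type*} [MeasurableSpace Ω]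
    {μ : Measure Ω} {Y : Ω → ℂ} {T : Ω → ℝ} (hT : AEMeasurable T μ) {δ : ℝ} (hδ : 0 < δ)
    (hint : ∀ t : ℝ, |t| ≤ δ → Integrable (fun ω => Y ω * Complex.exp (t * T ω)) μ) :
    Integrable (fun ω => Y ω * T ω) μ ∧
      HasDerivAt (fun t : ℝ => ∫ ω, Y ω * Complex.exp (t * T ω) ∂μ) (∫ ω, Y ω * T ω ∂μ) 0 := by
  have hY : Integrable Y μ := by simpa using hint 0 (by simpa using hδ.le)
  have hTc : AEStronglyMeasurable (fun ω => (T ω : ℂ)) μ :=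
    (Complex.measurable_ofReal.comp_aemeasurable hT).aestronglyMeasurable
  have key := hasDerivAt_integral_of_dominated_loc_of_deriv_le (μ := μ) (𝕜 := ℝ) (x₀ := 0)
    (F := fun t ω => Y ω * Complex.exp (t * T ω))
    (F' := fun t ω => Y ω * (T ω * Complex.exp (t * T ω)))
    (s := Metric.ball 0 (δ / 2))
    (bound := fun ω => 2 / δ * (‖Y ω * Complex.exp ((δ : ℝ) * T ω)‖ +
      ‖Y ω * Complex.exp ((-δ : ℝ) * T ω)‖))
    (Metric.ball_mem_nhds _ (by positivity)) ?_ ?_ ?_ ?_ ?_ ?_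
  · simpa using key
  · filter_upwards [Metric.ball_mem_nhds (0 : ℝ) hδ] with t ht
    exact (hint t (by simpa using (mem_ball_zero_iff.1 ht).le)).aestronglyMeasurable
  · simpa using hY
  · simpa [Pi.mul_def] using hY.aestronglyMeasurable.mul hTc
  · refine Eventually.of_forall fun ω t ht => ?_
    rw [mem_ball_zero_iff, Real.norm_eq_abs] at ht
    have hre : ∀ s : ℝ, ‖Complex.exp (s * T ω)‖ = Real.exp (s * T ω) := fun s => by
      rw [Complex.norm_exp]
      simp
    simp only [norm_mul, hre, Complex.norm_real, Real.norm_eq_abs]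
    have h1 : |T ω| ≤ 2 / δ * Real.exp (δ / 2 * |T ω|) := by
      have := Real.add_one_le_exp (δ / 2 * |T ω|)
      rw [div_mul_eq_mul_div, le_div_iff₀ hδ]
      nlinarith
    have h2 : Real.exp (t * T ω) ≤ Real.exp (δ / 2 * |T ω|) := by
      refine Real.exp_le_exp.2 ((le_abs_self _).trans ?_)
      rw [abs_mul]
      gcongr
    have h3 : Real.exp (δ / 2 * |T ω|) * Real.exp (δ / 2 * |T ω|) ≤
        Real.exp (δ * T ω) + Real.exp (-δ * T ω) := by
      rw [← Real.exp_add, ← add_mul, add_halves]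
      rcases abs_cases (T ω) with h | h <;> rw [h.1]
      · exact le_add_of_nonneg_right (Real.exp_pos _).le
      · rw [mul_neg, ← neg_mul]
        exact le_add_of_nonneg_left (Real.exp_pos _).le
    calc ‖Y ω‖ * (|T ω| * Real.exp (t * T ω))
        ≤ ‖Y ω‖ * (2 / δ * Real.exp (δ / 2 * |T ω|) * Real.exp (δ / 2 * |T ω|)) := by gcongr
      _ = 2 / δ * ‖Y ω‖ * (Real.exp (δ / 2 * |T ω|) * Real.exp (δ / 2 * |T ω|)) := by ring
      _ ≤ 2 / δ * ‖Y ω‖ * (Real.exp (δ * T ω) + Real.exp (-δ * T ω)) := by gcongr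
      _ = _ := by ring
  · exact (((hint δ (abs_of_pos hδ).le).norm).add
      ((hint (-δ) (by rw [abs_neg, abs_of_pos hδ])).norm)).const_mul _
  · refine Eventually.of_forall fun ω t _ => ?_
    have h : HasDerivAt (fun t : ℝ => (t : ℂ) * T ω) (T ω) t := by
      simpa using (Complex.ofRealCLM.hasDerivAt (x := t)).mul_const (T ω : ℂ)
    have := (h.cexp).const_mul (Y ω)
    rwa [mul_comm (Complex.exp _)] at this

lemma hasDerivAt_inv_sub_smul_apply {ι : Type*} [Fintype ι] [DecidableEq ι]
    {A : Matrix ι ι ℂ} (hA : IsUnit A) (H : Matrix ι ι ℂ) (i j : ι) :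
    HasDerivAt (fun t : ℝ => (A - (t : ℂ) • H)⁻¹ i j) ((A⁻¹ * H * A⁻¹) i j) 0 := by
  have hdet : Continuous fun t : ℝ => A - (t : ℂ) • H := by fun_prop
  have hd : A.det ≠ 0 := ((Matrix.isUnit_iff_isUnit_det A).1 hA).ne_zero
  have h0 : A - ((0 : ℝ) : ℂ) • H = A := by simp
  have hinv : ContinuousAt (fun t : ℝ => (A - (t : ℂ) • H)⁻¹) 0 := by
    refine ContinuousAt.comp (f := fun t : ℝ => A - (t : ℂ) • H) (g := Inv.inv) ?_
      hdet.continuousAt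
    refine continuousAt_matrix_inv _ ?_
    rw [h0, Ring.inverse_eq_inv']
    exact continuousAt_inv₀ hd
  have hev : ∀ᶠ t : ℝ in nhds 0, IsUnit (A - (t : ℂ) • H) := by
    have : ∀ᶠ t : ℝ in nhds 0, (A - (t : ℂ) • H).det ≠ 0 :=
      hdet.matrix_det.continuousAt.eventually_ne (by rwa [h0])
    filter_upwards [this] with t ht
    exact (Matrix.isUnit_iff_isUnit_det _).2 ht.isUnit
  rw [hasDerivAt_iff_tendsto_slope_zero]
  have hlim : Tendsto (fun t : ℝ => ((A - (t : ℂ) • H)⁻¹ * H * A⁻¹) i j) (nhdsWithin 0 {0}ᶜ)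
      (nhds ((A⁻¹ * H * A⁻¹) i j)) := by
    have h1 : ContinuousAt (fun t : ℝ => (A - (t : ℂ) • H)⁻¹ * H * A⁻¹) 0 :=
      (hinv.mul continuousAt_const).mul continuousAt_const
    have h2 := (continuousAt_pi.1 (continuousAt_pi.1 h1 i) j).tendsto
    simp only [Complex.ofReal_zero, zero_smul, sub_zero] at h2
    exact h2.mono_left nhdsWithin_le_nhds
  refine hlim.congr' ?_
  filter_upwards [hev.filter_mono nhdsWithin_le_nhds, self_mem_nhdsWithin] with t ht ht0
  have ht0' : (t : ℂ) ≠ 0 := by exact_mod_cast ht0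
  have hres : (A - (t : ℂ) • H)⁻¹ - A⁻¹ = (t : ℂ) • ((A - (t : ℂ) • H)⁻¹ * H * A⁻¹) := by
    rw [Matrix.inv_sub_inv (iff_of_true ht hA), sub_sub_cancel, Matrix.mul_smul, Matrix.smul_mul]
  simp only [zero_add, Complex.ofReal_zero, zero_smul, sub_zero]
  rw [← Matrix.sub_apply, hres, Matrix.smul_apply, Complex.real_smul, smul_eq_mul,
    Complex.ofReal_inv, inv_mul_cancel_left₀ ht0']

lemma hasDerivAt_det_sub_smul {ι : Type*} [Fintype ι] [DecidableEq ι]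
    {A : Matrix ι ι ℂ} (hA : IsUnit A) (H : Matrix ι ι ℂ) :
    HasDerivAt (fun t : ℝ => (A - (t : ℂ) • H).det) (-(A.det * (A⁻¹ * H).trace)) 0 := by
  have hd := (Matrix.isUnit_iff_isUnit_det A).1 hA
  have h1 : ∀ t : ℝ, (A - (t : ℂ) • H).det = A.det *
      ((1 + (Polynomial.X : Polynomial ℂ) • (-(A⁻¹ * H)).map Polynomial.C).det).eval (t : ℂ) := by
    intro t
    have : A - (t : ℂ) • H = A * (1 + (t : ℂ) • (-(A⁻¹ * H))) := by
      rw [mul_add, mul_one, Matrix.mul_smul, mul_neg, Matrix.mul_nonsing_inv_cancel_left _ _ hd,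
        smul_neg, sub_eq_add_neg]
    rw [this, Matrix.det_mul, ← Polynomial.coe_evalRingHom, RingHom.map_det]
    congr 2
    ext i j
    by_cases hij : i = j <;> simp [hij] <;> exact mul_comm _ _
  simp_rw [h1]
  have h2 := (Polynomial.hasDerivAt
    ((1 + (Polynomial.X : Polynomial ℂ) • (-(A⁻¹ * H)).map Polynomial.C).det)
      ((0 : ℝ) : ℂ)).comp_ofReal.const_mul A.det
  simpa [Matrix.derivative_det_one_add_X_smul] using h2

lemma exists_posDef_sub_smul {ι : Type*} [Fintype ι] [DecidableEq ι]
    {A H : Matrix ι ι ℂ} (hA : A.PosDef) (hH : H.IsHermitian) :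
    ∃ δ : ℝ, 0 < δ ∧ ∀ t : ℝ, |t| ≤ δ → (A - (t : ℂ) • H).PosDef := by
  have hcont : Continuous fun z : ℝ × (ι → ℂ) =>
      (star z.2 ⬝ᵥ ((A - (z.1 : ℂ) • H) *ᵥ z.2)).re := by
    refine Complex.continuous_re.comp ?_
    refine Continuous.dotProduct (by fun_prop) ?_
    refine Continuous.matrix_mulVec ?_ (by fun_prop)
    exact continuous_const.sub ((Complex.continuous_ofReal.comp continuous_fst).smul
      continuous_const)
  have hev : ∀ᶠ t : ℝ in nhds 0, ∀ x ∈ Metric.sphere (0 : ι → ℂ) 1,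
      0 < (star x ⬝ᵥ ((A - (t : ℂ) • H) *ᵥ x)).re := by
    refine (isCompact_sphere (0 : ι → ℂ) 1).eventually_forall_of_forall_eventually fun x hx => ?_
    refine hcont.continuousAt.eventually (lt_mem_nhds ?_)
    have hx0 : x ≠ 0 := by
      rintro rfl
      simp at hx
    simpa using (Complex.pos_iff.1 (hA.dotProduct_mulVec_pos hx0)).1
  obtain ⟨ε, hε, hball⟩ := Metric.eventually_nhds_iff.1 hev
  refine ⟨ε / 2, by positivity, fun t ht => ?_⟩
  have hherm : (A - (t : ℂ) • H).IsHermitian := hA.isHermitian.sub (by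
    rw [Matrix.IsHermitian, Matrix.conjTranspose_smul, hH.eq]
    simp)
  refine Matrix.PosDef.of_dotProduct_mulVec_pos hherm fun x hx => ?_
  have him := hherm.im_star_dotProduct_mulVec_self x
  rw [Complex.pos_iff]
  refine ⟨?_, by simpa using him.symm⟩
  have hn : ‖x‖ ≠ 0 := norm_ne_zero_iff.2 hx
  have h1 := hball (y := t) (by rw [Real.dist_eq, sub_zero]; linarith)
    (((‖x‖⁻¹ : ℝ) : ℂ) • x) (by simp [norm_smul, hn])
  rw [Matrix.mulVec_smul, star_smul, dotProduct_smul, smul_dotProduct] at h1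
  simp only [Complex.star_def, Complex.conj_ofReal, smul_eq_mul, Complex.re_ofReal_mul] at h1
  have hp : 0 < ‖x‖⁻¹ := by positivity
  exact pos_of_mul_pos_right (pos_of_mul_pos_right h1 hp.le) hp.le

/-- `∑_{σ ∈ S_n} q^{#C(σ)} ∏_j X_{a(σ j), b(j)}`, the mixed moment of the entries
`W_{a(j), b(j)}` of a Wishart matrix with scale `X` and shape `q`. -/
def permanentSum {n N : ℕ} (q : ℂ) (a b : Fin n → Fin N) (X : Matrix (Fin N) (Fin N) ℂ) : ℂ :=
  ∑ σ : Equiv.Perm (Fin n), q ^ cycleCount σ * ∏ j, X (a (σ j)) (b j)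

/-- The derivative of `permanentSum q a b` at `X` in the direction `X H X`, plus
`q tr(X H)` times its value. -/
def permanentSumDeriv {n N : ℕ} (q : ℂ) (a b : Fin n → Fin N)
    (X H : Matrix (Fin N) (Fin N) ℂ) : ℂ :=
  ∑ σ : Equiv.Perm (Fin n), q ^ cycleCount σ *
    ∑ x, (∏ y ∈ Finset.univ.erase x, X (a (σ y)) (b y)) * (X * H * X) (a (σ x)) (b x) +
  q * (X * H).trace * permanentSum q a b X

lemma permanentSumDeriv_add {n N : ℕ} (q : ℂ) (a b : Fin n → Fin N)
    (X H K : Matrix (Fin N) (Fin N) ℂ) :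
    permanentSumDeriv q a b X (H + K) =
      permanentSumDeriv q a b X H + permanentSumDeriv q a b X K := by
  simp only [permanentSumDeriv, mul_add, add_mul, Matrix.add_apply, Finset.sum_add_distrib,
    Matrix.trace_add]
  ring

lemma permanentSumDeriv_smul {n N : ℕ} (q : ℂ) (a b : Fin n → Fin N)
    (X H : Matrix (Fin N) (Fin N) ℂ) (c : ℂ) :
    permanentSumDeriv q a b X (c • H) = c * permanentSumDeriv q a b X H := by
  simp only [permanentSumDeriv, Matrix.mul_smul, Matrix.smul_mul, Matrix.smul_apply,
    Matrix.trace_smul, smul_eq_mul, mul_add, Finset.mul_sum]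
  congr 1
  · exact Finset.sum_congr rfl fun σ _ => Finset.sum_congr rfl fun x _ => by ring
  · ring

lemma permanentSum_succ {n N : ℕ} (q : ℂ) (a b : Fin (n + 1) → Fin N)
    (X : Matrix (Fin N) (Fin N) ℂ) :
    permanentSum q a b X =
      permanentSumDeriv q (fun j => a j.succ) (fun j => b j.succ) X
        (Matrix.single (b 0) (a 0) 1) := by
  have h1 : ∀ u v, (X * Matrix.single (b 0) (a 0) 1 * X : Matrix _ _ ℂ) u v = X u (b 0) * X (a 0) v := by
    intro u v
    rw [mul_assoc, Matrix.mul_apply, Finset.sum_eq_single (b 0)]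
    · simp
    · intro k _ hk
      simp [hk]
    · simp
  have h2 : (X * Matrix.single (b 0) (a 0) 1).trace = X (a 0) (b 0) := by
    simp [Matrix.trace_mul_single]
  rw [permanentSum, ← Equiv.Perm.decomposeFin.symm.sum_comp, Fintype.sum_prod_type,
    Fin.sum_univ_succ, Finset.sum_comm, add_comm, permanentSumDeriv]
  simp only [h1, h2]
  congr 1
  · refine Finset.sum_congr rfl fun e _ => ?_
    rw [← Equiv.sum_comp e, Finset.mul_sum]
    refine Finset.sum_congr rfl fun x _ => ?_
    rw [cycleCount_decomposeFin_symm_succ, Fin.prod_univ_succ,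
      ← Finset.mul_prod_erase _ _ (Finset.mem_univ x)]
    have : ∏ y ∈ Finset.univ.erase x,
        X (a (Equiv.Perm.decomposeFin.symm ((e x).succ, e) y.succ)) (b y.succ) =
        ∏ y ∈ Finset.univ.erase x, X (a (e y).succ) (b y.succ) := by
      refine Finset.prod_congr rfl fun y hy => ?_
      have hne : e y ≠ e x := fun h => (Finset.mem_erase.1 hy).1 (e.injective h)
      rw [Equiv.Perm.decomposeFin_symm_apply_succ,
        Equiv.swap_apply_of_ne_of_ne (Fin.succ_ne_zero _) (by simpa using hne)]
    rw [this]
    simp only [Equiv.Perm.decomposeFin_symm_apply_zero, Equiv.Perm.decomposeFin_symm_apply_succ,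
      Equiv.swap_apply_right]
    ring
  · rw [permanentSum, Finset.mul_sum]
    refine Finset.sum_congr rfl fun e _ => ?_
    rw [cycleCount_decomposeFin_symm_zero, Fin.prod_univ_succ]
    simp only [Equiv.Perm.decomposeFin_symm_apply_zero, Equiv.Perm.decomposeFin_symm_apply_succ,
      Equiv.swap_self, Equiv.refl_apply]
    ring

lemma det_one_sub_mul {N : ℕ} {S : Matrix (Fin N) (Fin N) ℂ} (hS : S.PosDef)
    (θ : Matrix (Fin N) (Fin N) ℂ) : (1 - θ * S).det = (S⁻¹ - θ).det * S.det := by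
  rw [← Matrix.det_mul, sub_mul,
    Matrix.nonsing_inv_mul _ ((Matrix.isUnit_iff_isUnit_det S).1 hS.isUnit)]

lemma det_one_sub_mul_pos {N : ℕ} {S θ : Matrix (Fin N) (Fin N) ℂ} (hS : S.PosDef)
    (hθ : (S⁻¹ - θ).PosDef) : 0 < (1 - θ * S).det := by
  rw [det_one_sub_mul hS]
  exact mul_pos hθ.det_pos hS.det_pos

lemma hasDerivAt_permanentSum_mul_cpow {n N : ℕ} {S θ : Matrix (Fin N) (Fin N) ℂ} (hS : S.PosDef)
    (hθ : (S⁻¹ - θ).PosDef) (q : ℂ) (a b : Fin n → Fin N) (H : Matrix (Fin N) (Fin N) ℂ) :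
    HasDerivAt (fun t : ℝ => permanentSum q a b (S⁻¹ - (θ + (t : ℂ) • H))⁻¹ *
        (1 - (θ + (t : ℂ) • H) * S).det ^ (-q))
      (permanentSumDeriv q a b (S⁻¹ - θ)⁻¹ H * (1 - θ * S).det ^ (-q)) 0 := by
  simp only [det_one_sub_mul hS, ← sub_sub]
  have hpos := det_one_sub_mul_pos hS hθ
  rw [det_one_sub_mul hS] at hpos
  set A := S⁻¹ - θ
  have hX := hasDerivAt_inv_sub_smul_apply hθ.isUnit H
  have hP := HasDerivAt.fun_sum (u := Finset.univ) fun (σ : Equiv.Perm (Fin n)) _ =>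
    (HasDerivAt.fun_finsetProd (u := Finset.univ) fun x _ =>
      hX (a (σ x)) (b x)).const_mul (q ^ cycleCount σ)
  have hslit : A.det * S.det ∈ Complex.slitPlane := Or.inl (Complex.pos_iff.1 hpos).1
  have hD := HasDerivAt.comp_of_eq (0 : ℝ)
    (Complex.hasStrictDerivAt_cpow_const (c := -q) hslit).hasDerivAt
    ((hasDerivAt_det_sub_smul hθ.isUnit H).mul_const S.det) (by simp)
  refine (hP.mul hD).congr_deriv ?_
  simp only [permanentSumDeriv, permanentSum, Complex.ofReal_zero, zero_smul, sub_zero,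
    smul_eq_mul, Function.comp_apply, Complex.cpow_sub _ _ hpos.ne', Complex.cpow_one]
  have hne := hpos.ne'
  have : (A.det * S.det) ^ (-q) / (A.det * S.det) *
      (-(A.det * (A⁻¹ * H).trace) * S.det) = -((A⁻¹ * H).trace * (A.det * S.det) ^ (-q)) := by
    rw [div_mul_eq_mul_div, div_eq_iff hne]
    ring
  rw [mul_assoc (-q), this]
  ring

theorem integrable_and_integral_prod_mul_exp {N : ℕ} {Ω : Type*} [MeasurableSpace Ω]
    {μ : Measure Ω} {S : Matrix (Fin N) (Fin N) ℂ} (hS : S.PosDef) {p : ℝ}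
    {W : Ω → Matrix (Fin N) (Fin N) ℂ} (hmeas : Measurable W) (hW : IsWishart μ W S p) {n : ℕ}
    (a b : Fin n → Fin N) {θ : Matrix (Fin N) (Fin N) ℂ} (hθ : θ.IsHermitian)
    (hpos : (S⁻¹ - θ).PosDef) :
    Integrable (fun ω => (∏ j, W ω (a j) (b j)) * Complex.exp (θ * W ω).trace) μ ∧
      ∫ ω, (∏ j, W ω (a j) (b j)) * Complex.exp (θ * W ω).trace ∂μ =
        permanentSum p a b (S⁻¹ - θ)⁻¹ * (1 - θ * S).det ^ (-(p : ℂ)) := by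
  induction n generalizing θ with
  | zero =>
    have hint := hW.2 θ hθ hpos
    refine ⟨?_, ?_⟩
    · by_contra hn
      simp only [Finset.univ_eq_empty, Finset.prod_empty, one_mul] at hn
      rw [integral_undef hn] at hint
      exact (det_one_sub_mul_pos hS hpos).ne' ((Complex.cpow_eq_zero_iff _ _).1 hint.symm).1
    · simp [permanentSum, cycleCount, cycleReps, hint]
  | succ n ih =>
    set a' : Fin n → Fin N := fun j => a j.succ
    set b' : Fin n → Fin N := fun j => b j.succ
    set Y : Ω → ℂ := fun ω => (∏ j, W ω (a' j) (b' j)) * Complex.exp (θ * W ω).trace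
    have hentry : ∀ i j, Measurable fun ω => W ω i j := fun i j =>
      (measurable_pi_apply j).comp ((measurable_pi_apply i).comp hmeas)
    have hherm : ∀ H : Matrix (Fin N) (Fin N) ℂ, H.IsHermitian →
        Integrable (fun ω => Y ω * (H * W ω).trace) μ ∧
        ∫ ω, Y ω * (H * W ω).trace ∂μ =
          permanentSumDeriv p a' b' (S⁻¹ - θ)⁻¹ H * (1 - θ * S).det ^ (-(p : ℂ)) := by
      intro H hH
      have hreal : ∀ ω, (((H * W ω).trace.re : ℝ) : ℂ) = (H * W ω).trace := by
        intro ω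
        rw [← Complex.conj_eq_iff_re, ← Complex.star_def, ← Matrix.trace_conjTranspose,
          Matrix.conjTranspose_mul, hH.eq, (hW.1 ω).eq, Matrix.trace_mul_comm]
      have hT : Measurable fun ω => (H * W ω).trace.re := by
        refine Complex.measurable_re.comp ?_
        simp only [Matrix.trace, Matrix.diag, Matrix.mul_apply]
        fun_prop
      obtain ⟨δ, hδ, hball⟩ := exists_posDef_sub_smul hpos hH
      have hθt : ∀ t : ℝ, (θ + (t : ℂ) • H).IsHermitian := fun t => hθ.add (by
        rw [Matrix.IsHermitian, Matrix.conjTranspose_smul, hH.eq]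
        simp)
      have hexp : ∀ (t : ℝ) ω, Y ω * Complex.exp (t * ((H * W ω).trace.re : ℝ)) =
          (∏ j, W ω (a' j) (b' j)) * Complex.exp ((θ + (t : ℂ) • H) * W ω).trace := by
        intro t ω
        rw [hreal, mul_assoc, ← Complex.exp_add, add_mul, Matrix.trace_add, Matrix.smul_mul,
          Matrix.trace_smul, smul_eq_mul]
      have hih := fun (t : ℝ) (ht : |t| ≤ δ) => ih a' b' (hθt t)
        (by rw [← sub_sub]; exact hball t ht)
      have key := integrable_mul_and_hasDerivAt_integral_mul_exp (μ := μ) (Y := Y)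
        hT.aemeasurable hδ fun t ht => by
          simp_rw [hexp]
          exact (hih t ht).1
      simp_rw [hreal] at key
      refine ⟨key.1, key.2.unique ?_⟩
      refine (hasDerivAt_permanentSum_mul_cpow hS hpos p a' b' H).congr_of_eventuallyEq ?_
      filter_upwards [Metric.ball_mem_nhds (0 : ℝ) hδ] with t ht
      rw [← (hih t (by simpa using (mem_ball_zero_iff.1 ht).le)).2]
      refine integral_congr_ae (Eventually.of_forall fun ω => ?_)
      have := hexp t ω
      rwa [hreal] at this
    set E : Matrix (Fin N) (Fin N) ℂ := Matrix.single (b 0) (a 0) 1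
    have h1 := hherm _ (realPart E).2
    have h2 := hherm _ (imaginaryPart E).2
    have hE := realPart_add_I_smul_imaginaryPart E
    have hY : (fun ω => (∏ j, W ω (a j) (b j)) * Complex.exp (θ * W ω).trace) = fun ω =>
        Y ω * ((realPart E : Matrix (Fin N) (Fin N) ℂ) * W ω).trace +
          Complex.I * (Y ω * ((imaginaryPart E : Matrix (Fin N) (Fin N) ℂ) * W ω).trace) := by
      funext ω
      have htr : W ω (a 0) (b 0) = (E * W ω).trace := by
        simp [E, Matrix.trace_single_mul]
      rw [Fin.prod_univ_succ, htr]
      conv_lhs => rw [← hE]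
      rw [add_mul, Matrix.trace_add, Matrix.smul_mul, Matrix.trace_smul, smul_eq_mul]
      simp only [Y, a', b']
      ring
    refine ⟨hY ▸ h1.1.add (h2.1.const_mul _), ?_⟩
    rw [hY, integral_add h1.1 (h2.1.const_mul _), integral_const_mul, h1.2, h2.2,
      permanentSum_succ]
    change _ = permanentSumDeriv p a' b' (S⁻¹ - θ)⁻¹ E * _
    conv_rhs => rw [← hE]
    rw [permanentSumDeriv_add, permanentSumDeriv_smul]
    ring

/-- Graczyk–Letac–Massam formula:
`E(r_{π₀}(h₁,…,h_n)(W)) = ∑_{π₁ ∈ S_n} p^{#C(π₁⁻¹ π₀)} r_{π₁}(h₁,…,h_n)(Σ)`. -/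
theorem wishart_rMonomial_moment
    {N n : ℕ} (hN : 1 ≤ N) (hn : 1 ≤ n)
    {Ω : Type*} [MeasurableSpace Ω] (μ : Measure Ω) [IsProbabilityMeasure μ]
    (S : Matrix (Fin N) (Fin N) ℂ) (hS : S.PosDef)
    (p : ℝ) (hp : ShapeParam N p)
    (W : Ω → Matrix (Fin N) (Fin N) ℂ) (hmeas : Measurable W)
    (hW : IsWishart μ W S p)
    (π₀ : Equiv.Perm (Fin n)) (h : Fin n → Matrix (Fin N) (Fin N) ℂ) :
    ∫ ω, rMonomial π₀ h (W ω) ∂μ =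
      ∑ π₁ : Equiv.Perm (Fin n), (p : ℂ) ^ cycleCount (π₁⁻¹ * π₀) * rMonomial π₁ h S := by
  have hSu := (Matrix.isUnit_iff_isUnit_det S).1 hS.isUnit
  have key : ∀ a b : Fin n → Fin N, Integrable (fun ω => ∏ j, W ω (a j) (b j)) μ ∧
      ∫ ω, ∏ j, W ω (a j) (b j) ∂μ = permanentSum p a b S := by
    intro a b
    simpa [Matrix.nonsing_inv_nonsing_inv _ hSu] using
      integrable_and_integral_prod_mul_exp hS hmeas hW a b Matrix.isHermitian_zero
        (by simpa using hS.inv)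
  simp_rw [rMonomial_eq_sum]
  rw [integral_finsetSum _ fun a _ => integrable_finsetSum _ fun b _ =>
    (key a b).1.const_mul _]
  simp_rw [integral_finsetSum _ fun b _ => (key _ b).1.const_mul _, integral_const_mul,
    (key _ _).2, permanentSum, Finset.mul_sum]
  rw [Finset.sum_congr rfl fun a _ => Finset.sum_comm, Finset.sum_comm]
  refine Fintype.sum_equiv ((Equiv.inv (Equiv.Perm (Fin n))).trans (Equiv.mulRight π₀)) _ _
    fun σ => ?_
  have hc : cycleCount ((σ⁻¹ * π₀)⁻¹ * π₀) = cycleCount σ := by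
    rw [← cycleCount_conj π₀⁻¹ σ]
    simp [mul_assoc]
  simp only [Equiv.trans_apply, Equiv.inv_apply, Equiv.coe_mulRight, hc]
  refine Fintype.sum_equiv (σ⁻¹.arrowCongr (Equiv.refl (Fin N))) _ _ fun a => ?_
  refine Finset.sum_congr rfl fun b _ => ?_
  have ha : ∀ j, σ⁻¹.arrowCongr (Equiv.refl (Fin N)) a j = a (σ j) := fun j => rfl
  simp only [ha, ← Equiv.Perm.mul_apply, mul_inv_cancel_left]
  ring

end
end

section
/- Let ξ_1, …, ξ_m be real-valued random variables with finite moments of all orders, and let (c_k)_{k ∈ ℕ^m} be their joint cumulants, defined by the moment–cumulant relation. If c_k = 0 for every multi-index k = (k_1,…,k_m) with k_1 + ⋯ + k_m ≥ 3, then the joint law of (ξ_1,…,ξ_m) is Gaussian, i.e., every real linear combination a_1 ξ_1 + ⋯ + a_m ξ_m has a (possibly degenerate) Gaussian distribution on ℝ. -/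
open MeasureTheory ProbabilityTheory Filter

noncomputable section

/-- The set of partitions of `univ : Finset γ` into nonempty disjoint blocks. -/
def partitionsOfUniv (γ : Type*) [Fintype γ] [DecidableEq γ] : Finset (Finset (Finset γ)) :=
  @Finset.filter _
    (fun P => (∀ B ∈ P, B.Nonempty) ∧ ∀ x : γ, ∃! B, B ∈ P ∧ x ∈ B)
    (Classical.decPred _) Finset.univ

/-- The moment–cumulant relation for real random variables `ξ₁,…,ξ_m`: for every multi-index
`k` with `k₁ + ⋯ + k_m ≥ 1`, `E(ξ₁^{k₁} ⋯ ξ_m^{k_m}) = ∑_{V ∈ P[1…n]} ∏_{B ∈ V} c_B`, where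
the partitions are of the set of `n = k₁ + ⋯ + k_m` positions (position `⟨j,·⟩` carrying the
variable `ξ_j`), and `c_B = c_{j₁,…,j_m}` with `j_r = #{u ∈ B : X_u = ξ_r}`. -/
def MomentCumulantRelation {Ω : Type*} [MeasurableSpace Ω] (μ : Measure Ω) {m : ℕ}
    (ξ : Fin m → Ω → ℝ) (c : (Fin m → ℕ) → ℝ) : Prop :=
  ∀ k : Fin m → ℕ, 1 ≤ ∑ j, k j →
    (∫ ω, ∏ j, ξ j ω ^ k j ∂μ) =
      ∑ P ∈ partitionsOfUniv ((j : Fin m) × Fin (k j)),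
        ∏ B ∈ P, c fun r => (B.filter fun u => u.1 = r).card

/-- Partitions of a finite set into nonempty disjoint blocks. -/
def partitionsOf {γ : Type*} [DecidableEq γ] (A : Finset γ) : Finset (Finset (Finset γ)) :=
  @Finset.filter _
    (fun P => (∀ B ∈ P, B.Nonempty) ∧ ∀ x ∈ A, ∃! B, B ∈ P ∧ x ∈ B)
    (Classical.decPred _) A.powerset.powerset

lemma mem_partitionsOf {γ : Type*} [DecidableEq γ] {A : Finset γ} {P : Finset (Finset γ)} :
    P ∈ partitionsOf A ↔
      (∀ B ∈ P, B ⊆ A) ∧ (∀ B ∈ P, B.Nonempty) ∧ ∀ x ∈ A, ∃! B, B ∈ P ∧ x ∈ B := by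
  simp only [partitionsOf, Finset.mem_filter, Finset.mem_powerset]
  refine and_congr_left fun _ => ⟨fun h B hB => Finset.mem_powerset.1 (h hB),
    fun h B hB => Finset.mem_powerset.2 (h B hB)⟩

lemma partitionsOf_empty {γ : Type*} [DecidableEq γ] :
    partitionsOf (∅ : Finset γ) = {∅} := by
  ext P
  simp only [mem_partitionsOf, Finset.mem_singleton]
  constructor
  · rintro ⟨h1, h2, -⟩
    refine Finset.eq_empty_of_forall_notMem fun B hB => ?_
    exact (h2 B hB).ne_empty (Finset.subset_empty.1 (h1 B hB))
  · rintro rfl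
    simp

lemma insert_mem_partitionsOf {γ : Type*} [DecidableEq γ] {A B : Finset γ}
    {P : Finset (Finset γ)} (hBA : B ⊆ A) (hB : B.Nonempty) (hP : P ∈ partitionsOf (A \ B)) :
    insert B P ∈ partitionsOf A := by
  rw [mem_partitionsOf] at hP ⊢
  obtain ⟨h1, h2, h3⟩ := hP
  refine ⟨?_, ?_, fun x hx => ?_⟩
  · intro D hD
    rcases Finset.mem_insert.1 hD with rfl | hD
    · exact hBA
    · exact (h1 D hD).trans Finset.sdiff_subset
  · intro D hD
    rcases Finset.mem_insert.1 hD with rfl | hD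
    · exact hB
    · exact h2 D hD
  · by_cases hxB : x ∈ B
    · refine ⟨B, ⟨Finset.mem_insert_self _ _, hxB⟩, ?_⟩
      rintro D ⟨hD, hxD⟩
      rcases Finset.mem_insert.1 hD with rfl | hD
      · rfl
      · exact absurd hxB (Finset.mem_sdiff.1 (h1 D hD hxD)).2
    · obtain ⟨D, ⟨hD, hxD⟩, hu⟩ := h3 x (Finset.mem_sdiff.2 ⟨hx, hxB⟩)
      refine ⟨D, ⟨Finset.mem_insert_of_mem hD, hxD⟩, ?_⟩
      rintro D' ⟨hD', hxD'⟩
      rcases Finset.mem_insert.1 hD' with rfl | hD'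
      · exact absurd hxD' hxB
      · exact hu D' ⟨hD', hxD'⟩

lemma eq_of_mem_partitionsOf {γ : Type*} [DecidableEq γ] {A B D : Finset γ}
    {P : Finset (Finset γ)} (hP : P ∈ partitionsOf A) (hB : B ∈ P) (hD : D ∈ P) {x : γ}
    (hxB : x ∈ B) (hxD : x ∈ D) : B = D := by
  rw [mem_partitionsOf] at hP
  exact (hP.2.2 x (hP.1 B hB hxB)).unique ⟨hB, hxB⟩ ⟨hD, hxD⟩

lemma erase_mem_partitionsOf {γ : Type*} [DecidableEq γ] {A B : Finset γ}
    {P : Finset (Finset γ)} (hP : P ∈ partitionsOf A) (hB : B ∈ P) :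
    P.erase B ∈ partitionsOf (A \ B) := by
  have hP' := hP
  rw [mem_partitionsOf] at hP' ⊢
  obtain ⟨h1, h2, h3⟩ := hP'
  refine ⟨fun D hD x hx => ?_, fun D hD => h2 D (Finset.mem_of_mem_erase hD), fun x hx => ?_⟩
  · obtain ⟨hne, hD⟩ := Finset.mem_erase.1 hD
    exact Finset.mem_sdiff.2
      ⟨h1 D hD hx, fun hxB => hne (eq_of_mem_partitionsOf hP hD hB hx hxB)⟩
  · obtain ⟨hxA, hxB⟩ := Finset.mem_sdiff.1 hx
    obtain ⟨D, ⟨hD, hxD⟩, hu⟩ := h3 x hxA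
    refine ⟨D, ⟨Finset.mem_erase.2 ⟨?_, hD⟩, hxD⟩, ?_⟩
    · rintro rfl
      exact hxB hxD
    · rintro D' ⟨hD', hxD'⟩
      exact hu D' ⟨Finset.mem_of_mem_erase hD', hxD'⟩

/-- Splitting off the block containing a given point. -/
lemma sum_partitionsOf_eq {γ : Type*} [DecidableEq γ] {R : Type*} [CommSemiring R]
    (w : Finset γ → R) {A : Finset γ} {x : γ} (hx : x ∈ A) :
    ∑ P ∈ partitionsOf A, ∏ B ∈ P, w B =
      ∑ B ∈ A.powerset with x ∈ B, w B * ∑ P ∈ partitionsOf (A \ B), ∏ D ∈ P, w D := by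
  simp_rw [Finset.mul_sum]
  rw [Finset.sum_sigma']
  symm
  have key : ∀ s ∈ (A.powerset.filter (x ∈ ·)).sigma (fun B => partitionsOf (A \ B)),
      s.1 ⊆ A ∧ x ∈ s.1 ∧ s.2 ∈ partitionsOf (A \ s.1) ∧ s.1 ∉ s.2 := by
    rintro ⟨B, P⟩ h
    simp only [Finset.mem_sigma, Finset.mem_filter, Finset.mem_powerset] at h
    refine ⟨h.1.1, h.1.2, h.2, fun hBP => ?_⟩
    exact (Finset.mem_sdiff.1 ((mem_partitionsOf.1 h.2).1 B hBP h.1.2)).2 h.1.2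
  refine Finset.sum_bij (fun s _ => insert s.1 s.2) ?_ ?_ ?_ ?_
  · intro s hs
    obtain ⟨h1, h2, h3, -⟩ := key s hs
    exact insert_mem_partitionsOf h1 ⟨x, h2⟩ h3
  · rintro ⟨B, P⟩ hs ⟨B', P'⟩ hs' heq
    obtain ⟨h1, h2, h3, h4⟩ := key _ hs
    obtain ⟨h1', h2', h3', h4'⟩ := key _ hs'
    dsimp only at *
    have hBB : B = B' := by
      refine eq_of_mem_partitionsOf (insert_mem_partitionsOf h1 ⟨x, h2⟩ h3)
        (Finset.mem_insert_self _ _) ?_ h2 h2'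
      rw [heq]
      exact Finset.mem_insert_self _ _
    subst hBB
    have : P = P' := by rw [← Finset.erase_insert h4, heq, Finset.erase_insert h4']
    rw [this]
  · intro P hP
    obtain ⟨B, ⟨hB, hxB⟩, -⟩ := (mem_partitionsOf.1 hP).2.2 x hx
    refine ⟨⟨B, P.erase B⟩, ?_, Finset.insert_erase hB⟩
    simp only [Finset.mem_sigma, Finset.mem_filter, Finset.mem_powerset]
    exact ⟨⟨(mem_partitionsOf.1 hP).1 B hB, hxB⟩, erase_mem_partitionsOf hP hB⟩
  · intro s hs
    rw [Finset.prod_insert (key s hs).2.2.2]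

/-- Wick-type recursion for weights supported on blocks with at most two elements. -/
lemma sum_partitionsOf_insert {γ : Type*} [DecidableEq γ] {R : Type*} [CommSemiring R]
    (w : Finset γ → R) (hw : ∀ B, 3 ≤ B.card → w B = 0) {A : Finset γ} {x : γ} (hx : x ∉ A) :
    ∑ P ∈ partitionsOf (insert x A), ∏ B ∈ P, w B =
      w {x} * ∑ P ∈ partitionsOf A, ∏ B ∈ P, w B +
        ∑ y ∈ A, w {x, y} * ∑ P ∈ partitionsOf (A.erase y), ∏ B ∈ P, w B := by
  rw [sum_partitionsOf_eq w (Finset.mem_insert_self x A)]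
  have hsub : insert {x} (A.image fun y => {x, y}) ⊆
      (insert x A).powerset.filter (x ∈ ·) := by
    intro B hB
    simp only [Finset.mem_insert, Finset.mem_image, Finset.mem_filter, Finset.mem_powerset] at hB ⊢
    grind
  rw [← Finset.sum_subset hsub, Finset.sum_insert, Finset.sum_image]
  · congr 1
    · congr 3
      grind
    · refine Finset.sum_congr rfl fun y hy => ?_
      congr 3
      grind
  · intro y hy z hz h
    have : y ∈ ({x, z} : Finset γ) := by
      have h' : ({x, y} : Finset γ) = {x, z} := h
      rw [← h']; simp
    grind
  · simp only [Finset.mem_image, not_exists, not_and]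
    intro y hy h
    have : y ∈ ({x} : Finset γ) := by rw [← h]; simp
    grind
  · intro B hB hB'
    rw [hw B, zero_mul]
    simp only [Finset.mem_filter, Finset.mem_powerset] at hB
    by_contra hlt
    apply hB'
    have hcard : (B.erase x).card ≤ 1 := by
      rw [Finset.card_erase_of_mem hB.2]; omega
    rw [Finset.mem_insert, Finset.mem_image]
    rcases (B.erase x).eq_empty_or_nonempty with h0 | ⟨y, hy⟩
    · left
      rw [← Finset.insert_erase hB.2, h0]
      rfl
    · right
      have hyB : B.erase x = {y} :=
        Finset.eq_singleton_iff_unique_mem.2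
          ⟨hy, fun z hz => Finset.card_le_one.1 hcard z hz y hy⟩
      refine ⟨y, ?_, ?_⟩
      · exact Finset.mem_of_mem_insert_of_ne (hB.1 (Finset.mem_of_mem_erase hy))
          (Finset.ne_of_mem_erase hy)
      · rw [← Finset.insert_erase hB.2, hyB]

/-- Partition sums over all of `β` transported along an embedding. -/
lemma sum_partitionsOf_map {β γ : Type*} [Fintype β] [DecidableEq β] [DecidableEq γ]
    {R : Type*} [CommSemiring R] (e : β ↪ γ) (w : Finset γ → R) :
    ∑ P ∈ partitionsOf (Finset.univ.map e), ∏ B ∈ P, w B =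
      ∑ P ∈ partitionsOfUniv β, ∏ B ∈ P, w (B.map e) := by
  symm
  refine Finset.sum_bij (fun P _ => P.map (Finset.mapEmbedding e).toEmbedding) ?_ ?_ ?_ ?_
  · intro P hP
    simp only [partitionsOfUniv, Finset.mem_filter, Finset.mem_univ, true_and] at hP
    rw [mem_partitionsOf]
    refine ⟨?_, ?_, ?_⟩
    · intro B hB
      obtain ⟨D, hD, rfl⟩ := Finset.mem_map.1 hB
      exact Finset.map_subset_map.2 (Finset.subset_univ _)
    · intro B hB
      obtain ⟨D, hD, rfl⟩ := Finset.mem_map.1 hB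
      exact (hP.1 D hD).map
    · intro y hy
      obtain ⟨x, -, rfl⟩ := Finset.mem_map.1 hy
      obtain ⟨D, ⟨hD, hxD⟩, hu⟩ := hP.2 x
      refine ⟨D.map e, ⟨Finset.mem_map_of_mem _ hD, Finset.mem_map_of_mem _ hxD⟩, ?_⟩
      rintro B ⟨hB, hxB⟩
      obtain ⟨D', hD', rfl⟩ := Finset.mem_map.1 hB
      have hxB : e x ∈ D'.map e := hxB
      rw [← hu D' ⟨hD', (Finset.mem_map' e).1 hxB⟩]
      rfl
  · intro P _ P' _ h
    exact Finset.map_injective _ h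
  · intro Q hQ
    rw [mem_partitionsOf] at hQ
    obtain ⟨h1, h2, h3⟩ := hQ
    refine ⟨Finset.univ.filter fun D => D.map e ∈ Q, ?_, ?_⟩
    · simp only [partitionsOfUniv, Finset.mem_filter, Finset.mem_univ, true_and]
      refine ⟨fun B hB => Finset.map_nonempty.1 (h2 _ hB), fun x => ?_⟩
      obtain ⟨B, ⟨hB, hxB⟩, hu⟩ := h3 (e x) (Finset.mem_map_of_mem _ (Finset.mem_univ x))
      obtain ⟨D, -, rfl⟩ := Finset.subset_map_iff.1 (h1 B hB)
      refine ⟨D, ⟨hB, (Finset.mem_map' e).1 hxB⟩, ?_⟩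
      rintro D' ⟨hD', hxD'⟩
      exact Finset.map_injective e (hu _ ⟨hD', Finset.mem_map_of_mem _ hxD'⟩)
    · ext B
      simp only [Finset.mem_map, Finset.mem_filter, Finset.mem_univ, true_and]
      constructor
      · rintro ⟨D, hD, rfl⟩
        exact hD
      · intro hB
        obtain ⟨D, -, rfl⟩ := Finset.subset_map_iff.1 (h1 B hB)
        exact ⟨D, hB, rfl⟩
  · intro P _
    rw [Finset.prod_map]
    rfl

/-- Partition sums of a weight depending only on the number of points of each colour. -/
lemma sum_partitionsOf_card_filter {γ ι : Type*} [DecidableEq γ] [Fintype ι] [DecidableEq ι]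
    {R : Type*} [CommSemiring R] (f : γ → ι) (c : (ι → ℕ) → R) (A : Finset γ) :
    ∑ P ∈ partitionsOf A, ∏ B ∈ P, c (fun r => (B.filter fun u => f u = r).card) =
      ∑ P ∈ partitionsOfUniv ((j : ι) × Fin ((A.filter fun u => f u = j).card)),
        ∏ B ∈ P, c fun r => (B.filter fun u => u.1 = r).card := by
  let e : ((j : ι) × Fin ((A.filter fun u => f u = j).card)) ↪ γ :=
    ⟨fun s => ((A.filter fun u => f u = s.1).equivFin.symm s.2 : γ), by
      rintro ⟨j, s⟩ ⟨j', s'⟩ h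
      dsimp only at h
      have h1 := (Finset.mem_filter.1 ((A.filter fun u => f u = j).equivFin.symm s).2).2
      have h2 := (Finset.mem_filter.1 ((A.filter fun u => f u = j').equivFin.symm s').2).2
      obtain rfl : j = j' := by rw [← h1, ← h2, h]
      rw [(Equiv.injective _ (Subtype.ext h) : s = s')]⟩
  have hfe : ∀ s, f (e s) = s.1 := fun s =>
    (Finset.mem_filter.1 ((A.filter fun u => f u = s.1).equivFin.symm s.2).2).2
  have hA : Finset.univ.map e = A := by
    ext x
    simp only [Finset.mem_map, Finset.mem_univ, true_and]
    constructor
    · rintro ⟨s, rfl⟩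
      exact (Finset.mem_filter.1 ((A.filter fun u => f u = s.1).equivFin.symm s.2).2).1
    · intro hx
      refine ⟨⟨f x, (A.filter fun u => f u = f x).equivFin
        ⟨x, Finset.mem_filter.2 ⟨hx, rfl⟩⟩⟩, ?_⟩
      change (((A.filter fun u => f u = f x).equivFin.symm
        ((A.filter fun u => f u = f x).equivFin ⟨x, _⟩) : _) : γ) = x
      rw [Equiv.symm_apply_apply]
  conv_lhs => rw [← hA]
  rw [sum_partitionsOf_map]
  simp only [Finset.filter_map, Finset.card_map, Function.comp_def, hfe]

section Moments

variable {Ω : Type*} [MeasurableSpace Ω] {μ : Measure Ω} {m : ℕ} {ξ : Fin m → Ω → ℝ}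
  {c : (Fin m → ℕ) → ℝ}

lemma integral_prod_pow_card_filter [IsProbabilityMeasure μ]
    (hc : MomentCumulantRelation μ ξ c) {γ : Type*} [DecidableEq γ] (f : γ → Fin m)
    (A : Finset γ) :
    ∫ ω, ∏ j, ξ j ω ^ (A.filter fun u => f u = j).card ∂μ =
      ∑ P ∈ partitionsOf A, ∏ B ∈ P, c (fun r => (B.filter fun u => f u = r).card) := by
  rcases A.eq_empty_or_nonempty with rfl | hA
  · simp [partitionsOf_empty]
  · rw [sum_partitionsOf_card_filter]
    refine hc _ ?_
    rw [← Finset.card_eq_sum_card_fiberwise (fun _ _ => Finset.mem_coe.2 (Finset.mem_univ _))]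
    exact hA.card_pos

/-- Integration by parts for monomials. -/
lemma integral_mul_prod_pow [IsProbabilityMeasure μ] (hc : MomentCumulantRelation μ ξ c)
    (hvanish : ∀ k : Fin m → ℕ, 3 ≤ ∑ j, k j → c k = 0) (i : Fin m) (k : Fin m → ℕ) :
    ∫ ω, ξ i ω * ∏ j, ξ j ω ^ k j ∂μ =
      c (Pi.single i 1) * ∫ ω, ∏ j, ξ j ω ^ k j ∂μ +
        ∑ j, c (Pi.single i 1 + Pi.single j 1) *
          (k j * ∫ ω, ∏ l, ξ l ω ^ (k - Pi.single j 1 : Fin m → ℕ) l ∂μ) := by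
  classical
  let f : Option ((j : Fin m) × Fin (k j)) → Fin m := fun o => o.elim i Sigma.fst
  let A : Finset (Option ((j : Fin m) × Fin (k j))) := Finset.univ.map Function.Embedding.some
  have hA : none ∉ A := by simp [A]
  let w : Finset (Option ((j : Fin m) × Fin (k j))) → ℝ :=
    fun B => c fun r => (B.filter fun u => f u = r).card
  have hcard (j : Fin m) : (A.filter fun u => f u = j).card = k j := by
    have : (Finset.univ.filter fun u : (j : Fin m) × Fin (k j) => u.1 = j) =
        Finset.univ.map (Function.Embedding.sigmaMk j) := by
      ext ⟨a, b⟩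
      simp only [Finset.mem_filter, Finset.mem_univ, true_and, Finset.mem_map,
        Function.Embedding.sigmaMk_apply]
      constructor
      · rintro rfl
        exact ⟨b, rfl⟩
      · rintro ⟨b', h⟩
        exact (congrArg Sigma.fst h).symm
    simp only [A, f, Finset.filter_map, Finset.card_map, Function.comp_def,
      Function.Embedding.some_apply, Option.elim_some]
    rw [this, Finset.card_map, Finset.card_univ, Fintype.card_fin]
  have hw (B) (hB : 3 ≤ B.card) : w B = 0 := by
    refine hvanish _ ?_
    rwa [← Finset.card_eq_sum_card_fiberwise (fun _ _ => Finset.mem_coe.2 (Finset.mem_univ _))]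
  have hsingle (u) : (fun r => (({u} : Finset _).filter fun u => f u = r).card) =
      Pi.single (f u) 1 := by
    ext r
    rw [Finset.filter_singleton, Pi.single_apply]
    split_ifs <;> simp_all
  have hinsert (u) (B : Finset (Option ((j : Fin m) × Fin (k j)))) (hu : u ∉ B) :
      (fun r => ((insert u B).filter fun u => f u = r).card) =
        Pi.single (f u) 1 + fun r => (B.filter fun u => f u = r).card := by
    ext r
    rw [Finset.filter_insert, Pi.add_apply, Pi.single_apply]
    split_ifs with h1 h2 h2
    · rw [Finset.card_insert_of_notMem (by simp [hu]), add_comm]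
    · exact absurd h1.symm h2
    · exact absurd h2.symm h1
    · simp
  have key := sum_partitionsOf_insert w hw hA
  simp only [w, ← integral_prod_pow_card_filter hc f] at key
  have hL : ∀ ω, ∏ j, ξ j ω ^ ((insert none A).filter fun u => f u = j).card =
      ξ i ω * ∏ j, ξ j ω ^ k j := by
    intro ω
    have : ∀ j, ((insert none A).filter fun u => f u = j).card =
        (Pi.single i 1 : Fin m → ℕ) j + k j := fun j => by
      rw [← hcard j]; exact congrFun (hinsert none A hA) j
    simp only [this, pow_add, Finset.prod_mul_distrib]
    congr 1
    rw [Finset.prod_eq_single i (fun j _ hj => by simp [hj]) (by simp)]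
    simp
  simp only [hL, hcard, hsingle] at key
  rw [key]
  congr 1
  have hpair : ∀ y ∈ A,
      c (fun r => (({none, y} : Finset _).filter fun u => f u = r).card) *
        ∫ ω, ∏ j, ξ j ω ^ ((A.erase y).filter fun u => f u = j).card ∂μ =
      c (Pi.single i 1 + Pi.single (f y) 1) *
          ∫ ω, ∏ l, ξ l ω ^ (k - Pi.single (f y) 1 : Fin m → ℕ) l ∂μ := by
    intro y hy
    rw [hinsert none {y} (by rintro h; exact hA (Finset.mem_singleton.1 h ▸ hy)), hsingle]
    have : (fun j => ((A.erase y).filter fun u => f u = j).card) = k - Pi.single (f y) 1 := by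
      have h := hinsert y (A.erase y) (Finset.notMem_erase _ _)
      rw [Finset.insert_erase hy] at h
      simp only [hcard] at h
      have h : k = _ := h
      conv_rhs => rw [h]
      rw [add_tsub_cancel_left]
    simp only [← this]
    rfl
  rw [Finset.sum_congr rfl hpair]
  refine (Finset.sum_comp (fun j => c (Pi.single i 1 + Pi.single j 1) *
    ∫ ω, ∏ l, ξ l ω ^ (k - Pi.single j 1 : Fin m → ℕ) l ∂μ) f).trans ?_
  rw [Finset.sum_subset (Finset.subset_univ _)]
  · refine Finset.sum_congr rfl fun j _ => ?_
    rw [hcard, nsmul_eq_mul]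
    ring
  · intro j _ hj
    rw [Finset.card_eq_zero.2, zero_smul]
    exact Finset.filter_eq_empty_iff.2 fun u hu h => hj (Finset.mem_image.2 ⟨u, hu, h⟩)

open MvPolynomial

lemma integrable_eval_mvPolynomial
    (hint : ∀ k : Fin m → ℕ, Integrable (fun ω => ∏ j, ξ j ω ^ k j) μ)
    (p : MvPolynomial (Fin m) ℝ) : Integrable (fun ω => eval (fun j => ξ j ω) p) μ := by
  induction p using MvPolynomial.induction_on' with
  | monomial u a =>
    simp only [eval_monomial, Finsupp.prod_fintype _ _ (fun _ => pow_zero _)]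
    exact (hint u).const_mul a
  | add p q hp hq =>
    simp only [map_add]
    exact hp.add hq

/-- Integration by parts for polynomials. -/
lemma integral_eval_X_mul [IsProbabilityMeasure μ]
    (hint : ∀ k : Fin m → ℕ, Integrable (fun ω => ∏ j, ξ j ω ^ k j) μ)
    (hc : MomentCumulantRelation μ ξ c)
    (hvanish : ∀ k : Fin m → ℕ, 3 ≤ ∑ j, k j → c k = 0) (i : Fin m)
    (p : MvPolynomial (Fin m) ℝ) :
    ∫ ω, eval (fun j => ξ j ω) (X i * p) ∂μ =
      c (Pi.single i 1) * ∫ ω, eval (fun j => ξ j ω) p ∂μ +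
        ∑ j, c (Pi.single i 1 + Pi.single j 1) *
          ∫ ω, eval (fun j => ξ j ω) (pderiv j p) ∂μ := by
  have hI := integrable_eval_mvPolynomial hint
  induction p using MvPolynomial.induction_on' with
  | monomial u a =>
    have h := integral_mul_prod_pow hc hvanish i u
    simp only [map_mul, eval_X, pderiv_monomial, eval_monomial,
      Finsupp.prod_fintype _ _ (fun _ => pow_zero _), mul_left_comm _ a, integral_const_mul, h]
    rw [mul_add, Finset.mul_sum, mul_left_comm]
    congr 1
    refine Finset.sum_congr rfl fun j _ => ?_
    have : ∀ l, (u - Finsupp.single j 1 : Fin m →₀ ℕ) l = (⇑u - Pi.single j 1 : Fin m → ℕ) l := by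
      intro l
      simp [Finsupp.single_eq_pi_single]
    simp only [this]
    ring
  | add p q hp hq =>
    simp only [mul_add, map_add]
    rw [integral_add (hI _) (hI _), integral_add (hI _) (hI _), hp, hq]
    simp_rw [integral_add (hI _) (hI _), mul_add, Finset.sum_add_distrib]
    ring

/-- Moment recursion for the centred linear combination. -/
lemma integral_centred_pow_succ [IsProbabilityMeasure μ]
    (hint : ∀ k : Fin m → ℕ, Integrable (fun ω => ∏ j, ξ j ω ^ k j) μ)
    (hc : MomentCumulantRelation μ ξ c)
    (hvanish : ∀ k : Fin m → ℕ, 3 ≤ ∑ j, k j → c k = 0) (a : Fin m → ℝ) (n : ℕ) :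
    ∫ ω, ((∑ j, a j * ξ j ω) - ∑ j, a j * c (Pi.single j 1)) ^ (n + 1) ∂μ =
      (∑ i, ∑ j, a i * a j * c (Pi.single i 1 + Pi.single j 1)) *
        (n * ∫ ω, ((∑ j, a j * ξ j ω) - ∑ j, a j * c (Pi.single j 1)) ^ (n - 1) ∂μ) := by
  set κ := ∑ j, a j * c (Pi.single j 1) with hκ
  let L : MvPolynomial (Fin m) ℝ := (∑ j, C (a j) * X j) - C κ
  have hL : ∀ ω, eval (fun j => ξ j ω) L = (∑ j, a j * ξ j ω) - κ := by
    intro ω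
    simp [L]
  have hder : ∀ j, pderiv j L = C (a j) := by
    intro j
    simp [L, pderiv_X, Pi.single_apply]
  have hI := integrable_eval_mvPolynomial (μ := μ) hint
  have hexp : ∀ ω, ((∑ j, a j * ξ j ω) - κ) ^ (n + 1) =
      (∑ i, a i * eval (fun j => ξ j ω) (X i * L ^ n)) -
        κ * eval (fun j => ξ j ω) (L ^ n) := by
    intro ω
    simp only [map_mul, map_pow, hL, eval_X, ← mul_assoc, ← Finset.sum_mul]
    ring
  simp only [hexp]
  rw [integral_sub (integrable_finsetSum _ fun i _ => (hI _).const_mul _) ((hI _).const_mul _),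
    integral_finsetSum _ fun i _ => (hI _).const_mul _]
  simp only [integral_const_mul, integral_eval_X_mul hint hc hvanish]
  simp only [pderiv_pow, hder, map_mul, map_pow, map_natCast, eval_C, hL, integral_mul_const,
    integral_const_mul]
  have hsplit : ∑ i, a i * (c (Pi.single i 1) * ∫ ω, ((∑ j, a j * ξ j ω) - κ) ^ n ∂μ) =
      κ * ∫ ω, ((∑ j, a j * ξ j ω) - κ) ^ n ∂μ := by
    simp only [hκ, Finset.sum_mul, mul_assoc]
  simp only [mul_add, Finset.sum_add_distrib]
  rw [hsplit, add_sub_cancel_left]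
  simp only [Finset.sum_mul, Finset.mul_sum]
  refine Finset.sum_congr rfl fun i _ => Finset.sum_congr rfl fun j _ => ?_
  ring

end Moments

section GaussianMoments

variable {Ω : Type*} [MeasurableSpace Ω] {μ : Measure Ω} {X : Ω → ℝ} {v : NNReal}

lemma integral_pow_even_le [IsProbabilityMeasure μ]
    (hrec : ∀ n : ℕ, ∫ ω, X ω ^ (n + 1) ∂μ = v * (n * ∫ ω, X ω ^ (n - 1) ∂μ)) (n : ℕ) :
    ∫ ω, X ω ^ (2 * n) ∂μ ≤ (2 * v) ^ n * n.factorial := by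
  induction n with
  | zero => simp
  | succ n ih =>
    rw [show 2 * (n + 1) = 2 * n + 1 + 1 by ring, hrec, Nat.add_sub_cancel, Nat.factorial_succ]
    push_cast
    calc (v : ℝ) * ((2 * n + 1) * ∫ ω, X ω ^ (2 * n) ∂μ)
        ≤ v * ((2 * n + 2) * ((2 * v) ^ n * n.factorial)) := by
          gcongr
          · exact integral_nonneg fun ω => (even_two_mul n).pow_nonneg _
          · norm_num
      _ = _ := by ring

lemma integral_pow_even_eq [IsProbabilityMeasure μ]
    (hrec : ∀ n : ℕ, ∫ ω, X ω ^ (n + 1) ∂μ = v * (n * ∫ ω, X ω ^ (n - 1) ∂μ)) (n : ℕ) :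
    (∫ ω, X ω ^ (2 * n) ∂μ) / (2 * n).factorial = (v / 2) ^ n / n.factorial := by
  induction n with
  | zero => simp
  | succ n ih =>
    rw [div_eq_div_iff (by positivity) (by positivity)] at ih ⊢
    rw [show 2 * (n + 1) = 2 * n + 1 + 1 by ring, hrec, Nat.add_sub_cancel, Nat.factorial_succ,
      Nat.factorial_succ, Nat.factorial_succ]
    push_cast
    linear_combination (v * (2 * n + 1) * (n + 1) : ℝ) * ih

lemma integral_pow_odd_eq
    (hrec : ∀ n : ℕ, ∫ ω, X ω ^ (n + 1) ∂μ = v * (n * ∫ ω, X ω ^ (n - 1) ∂μ)) (n : ℕ) :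
    ∫ ω, X ω ^ (2 * n + 1) ∂μ = 0 := by
  induction n with
  | zero => rw [hrec]; simp
  | succ n ih =>
    rw [hrec, show 2 * (n + 1) - 1 = 2 * n + 1 by omega, ih]
    simp

lemma summable_integral_norm_pow_div_factorial [IsProbabilityMeasure μ]
    (hint : ∀ n : ℕ, Integrable (fun ω => X ω ^ n) μ)
    (hrec : ∀ n : ℕ, ∫ ω, X ω ^ (n + 1) ∂μ = v * (n * ∫ ω, X ω ^ (n - 1) ∂μ)) (t : ℝ) :
    Summable fun n : ℕ => ∫ ω, |t * X ω| ^ n / n.factorial ∂μ := by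
  have hs : Summable fun n : ℕ => (1 / 2 : ℝ) ^ n + (4 * v * t ^ 2) ^ n / n.factorial :=
    summable_geometric_two.add (Real.summable_pow_div_factorial _)
  refine Summable.of_nonneg_of_le (fun n => integral_nonneg fun ω => by positivity)
    (fun n => ?_) hs
  have hpt : ∀ ω, |t * X ω| ^ n / n.factorial ≤
      (1 / 2 : ℝ) ^ n + (2 * t ^ 2) ^ n / (n.factorial : ℝ) ^ 2 * X ω ^ (2 * n) := by
    intro ω
    set u := |t * X ω| ^ n / n.factorial with hu
    have h2 : (2 * t ^ 2) ^ n / (n.factorial : ℝ) ^ 2 * X ω ^ (2 * n) = 2 ^ n * u ^ 2 := by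
      rw [hu, div_pow, ← pow_mul, mul_comm n 2, pow_mul |t * X ω|, sq_abs, mul_pow, mul_pow,
        mul_pow, pow_mul (X ω)]
      ring
    have h3 : (1 / 2 : ℝ) ^ n * 2 ^ n = 1 := by
      rw [← mul_pow]; norm_num
    rw [h2]
    have hp : (0 : ℝ) < 2 ^ n := by positivity
    have hq : (0 : ℝ) < (1 / 2) ^ n := by positivity
    have : (1 / 2 : ℝ) ^ n + 2 ^ n * u ^ 2 - u =
        (1 / 2) ^ n * ((2 ^ n * u - 1 / 2) ^ 2 + 3 / 4) := by
      linear_combination (-2 ^ n * u ^ 2 + u) * h3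
    have : 0 < (1 / 2 : ℝ) ^ n * ((2 ^ n * u - 1 / 2) ^ 2 + 3 / 4) := by positivity
    linarith
  have hi : Integrable (fun ω => (1 / 2 : ℝ) ^ n +
      (2 * t ^ 2) ^ n / (n.factorial : ℝ) ^ 2 * X ω ^ (2 * n)) μ :=
    (integrable_const _).add ((hint _).const_mul _)
  calc ∫ ω, |t * X ω| ^ n / n.factorial ∂μ
      ≤ ∫ ω, ((1 / 2 : ℝ) ^ n + (2 * t ^ 2) ^ n / (n.factorial : ℝ) ^ 2 * X ω ^ (2 * n)) ∂μ :=
        integral_mono_of_nonneg (Eventually.of_forall fun ω => by positivity) hi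
          (Eventually.of_forall hpt)
    _ = (1 / 2 : ℝ) ^ n +
        (2 * t ^ 2) ^ n / (n.factorial : ℝ) ^ 2 * ∫ ω, X ω ^ (2 * n) ∂μ := by
        rw [integral_add (integrable_const _) ((hint _).const_mul _), integral_const_mul]
        simp
    _ ≤ (1 / 2 : ℝ) ^ n +
        (2 * t ^ 2) ^ n / (n.factorial : ℝ) ^ 2 * ((2 * v) ^ n * n.factorial) := by
        gcongr
        exact integral_pow_even_le hrec n
    _ = _ := by
        have : (n.factorial : ℝ) ≠ 0 := by positivity
        rw [show 4 * (v : ℝ) * t ^ 2 = 2 * t ^ 2 * (2 * v) by ring, mul_pow _ (2 * (v : ℝ))]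
        field_simp

/-- The moment recursion of a centred Gaussian determines the law. -/
lemma map_eq_gaussianReal_of_integral_pow_succ [IsProbabilityMeasure μ] (hX : Measurable X)
    (hint : ∀ n : ℕ, Integrable (fun ω => X ω ^ n) μ)
    (hrec : ∀ n : ℕ, ∫ ω, X ω ^ (n + 1) ∂μ = v * (n * ∫ ω, X ω ^ (n - 1) ∂μ)) :
    μ.map X = gaussianReal 0 v := by
  have := Measure.isProbabilityMeasure_map (μ := μ) hX.aemeasurable
  refine Measure.ext_of_charFun (funext fun t => ?_)
  rw [charFun_gaussianReal, charFun_apply_real,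
    integral_map hX.aemeasurable (by fun_prop)]
  let F : ℕ → Ω → ℂ := fun n ω => (t * X ω * Complex.I) ^ n / n.factorial
  have hF : ∀ n, F n = fun ω => ((t * Complex.I) ^ n / n.factorial) * ((X ω ^ n : ℝ) : ℂ) := by
    intro n
    ext ω
    simp only [F]
    push_cast
    ring
  have hsum := hasSum_integral_of_summable_integral_norm (F := F) (μ := μ)
    (fun n => by rw [hF]; exact (hint n).ofReal.const_mul _) (by
      convert summable_integral_norm_pow_div_factorial hint hrec t using 4 with n ω
      simp [F, abs_mul])
  have hexp : ∀ ω, ∑' n, F n ω = Complex.exp (t * X ω * Complex.I) := fun ω => by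
    rw [Complex.exp_eq_exp_ℂ, NormedSpace.exp_eq_tsum_div]
  simp only [hexp] at hsum
  have hval : ∀ n, ∫ ω, F n ω ∂μ =
      (t * Complex.I) ^ n * (((∫ ω, X ω ^ n ∂μ) / n.factorial : ℝ) : ℂ) := by
    intro n
    rw [hF, integral_const_mul, integral_complex_ofReal]
    push_cast
    ring
  simp only [hval] at hsum
  have heven : HasSum (fun n : ℕ => (-(v * t ^ 2 / 2 : ℂ)) ^ n / n.factorial)
      (∫ ω, Complex.exp (t * X ω * Complex.I) ∂μ) := by
    rw [← Function.Injective.hasSum_iff (g := fun n : ℕ => 2 * n)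
      (fun a b h => by simpa using h)] at hsum
    · refine (congrArg (HasSum · _) (funext fun n => ?_)).mpr hsum
      rw [Function.comp_apply, integral_pow_even_eq hrec, pow_mul,
        show -(v * t ^ 2 / 2 : ℂ) = (t * Complex.I) ^ 2 * (v / 2) by
          rw [mul_pow, Complex.I_sq]; ring, mul_pow _ (v / 2 : ℂ), mul_div_assoc]
      push_cast
      rfl
    · intro n hn
      obtain ⟨k, rfl⟩ : Odd n := by
        rw [← Nat.not_even_iff_odd]
        rintro ⟨k, rfl⟩
        exact hn ⟨k, by ring⟩
      simp [integral_pow_odd_eq hrec]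
  have hgauss : HasSum (fun n : ℕ => (-(v * t ^ 2 / 2 : ℂ)) ^ n / n.factorial)
      (Complex.exp (-(v * t ^ 2 / 2 : ℂ))) := by
    rw [Complex.exp_eq_exp_ℂ]
    exact NormedSpace.expSeries_div_hasSum_exp _
  rw [heven.unique hgauss]
  congr 1
  simp

end GaussianMoments

/-- If all joint cumulants of order `≥ 3` of real random variables `ξ₁,…,ξ_m` (having all
moments) vanish, then the joint law of `(ξ₁,…,ξ_m)` is Gaussian: every real linear combination
has a (possibly degenerate) Gaussian distribution. -/
theorem gaussian_of_vanishing_higher_cumulants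
    {Ω : Type*} [MeasurableSpace Ω] (μ : Measure Ω) [IsProbabilityMeasure μ]
    {m : ℕ} (ξ : Fin m → Ω → ℝ) (hmeas : ∀ j, Measurable (ξ j))
    (hint : ∀ k : Fin m → ℕ, Integrable (fun ω => ∏ j, ξ j ω ^ k j) μ)
    (c : (Fin m → ℕ) → ℝ) (hc : MomentCumulantRelation μ ξ c)
    (hvanish : ∀ k : Fin m → ℕ, 3 ≤ ∑ j, k j → c k = 0) :
    ∀ a : Fin m → ℝ, ∃ (m₀ : ℝ) (v : NNReal),
      Measure.map (fun ω => ∑ j, a j * ξ j ω) μ = gaussianReal m₀ v := by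
  intro a
  set κ := ∑ j, a j * c (Pi.single j 1)
  set X : Ω → ℝ := fun ω => (∑ j, a j * ξ j ω) - κ with hX
  have hXmeas : Measurable X :=
    (Finset.measurable_fun_sum _ fun j _ => (hmeas j).const_mul _).sub_const _
  obtain ⟨v, hrec⟩ : ∃ v : ℝ, ∀ n : ℕ,
      ∫ ω, X ω ^ (n + 1) ∂μ = v * (n * ∫ ω, X ω ^ (n - 1) ∂μ) :=
    ⟨_, integral_centred_pow_succ hint hc hvanish a⟩
  have hv : 0 ≤ v := by
    have h := hrec 1
    simp only [Nat.cast_one, Nat.sub_self, pow_zero, integral_const, probReal_univ, smul_eq_mul,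
      mul_one] at h
    rw [← h]
    exact integral_nonneg fun ω => even_two.pow_nonneg _
  lift v to NNReal using hv
  have hXint : ∀ n : ℕ, Integrable (fun ω => X ω ^ n) μ := by
    intro n
    have h := integrable_eval_mvPolynomial hint
      (((∑ j, MvPolynomial.C (a j) * MvPolynomial.X j) - MvPolynomial.C κ) ^ n)
    simpa using h
  have hlaw := map_eq_gaussianReal_of_integral_pow_succ hXmeas hXint hrec
  refine ⟨0 + κ, v, ?_⟩
  rw [← gaussianReal_map_add_const, ← hlaw, Measure.map_map (by fun_prop) hXmeas]
  congr 1
  ext ω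
  simp [hX]

end
end

section
/- Let ξ and η be independent complex-valued random variables, where ξ is real N(0,1) and η is uniformly distributed on the unit circle {z ∈ ℂ : |z| = 1}. Then for every integer n ≥ 1, E( (ξ + η)^n ) = E( ξ^n ); that is, ξ + η has the same (non-conjugated) moments of all orders as the standard real Gaussian law N(0,1). -/
open MeasureTheory ProbabilityTheory Filter

noncomputable section

/-- The nonzero Fourier modes integrate to zero over a period. -/
theorem setIntegral_Ico_exp_mul_I_pow_eq_zero {k : ℕ} (hk : k ≠ 0) :
    ∫ θ : ℝ in Set.Ico (0 : ℝ) (2 * Real.pi), Complex.exp (θ * Complex.I) ^ k = 0 := by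
  have hc : (k : ℂ) * Complex.I ≠ 0 := mul_ne_zero (by exact_mod_cast hk) Complex.I_ne_zero
  rw [integral_Ico_eq_integral_Ioc, ← intervalIntegral.integral_of_le Real.two_pi_pos.le]
  have h (θ : ℝ) : Complex.exp (θ * Complex.I) ^ k = Complex.exp (k * Complex.I * θ) := by
    rw [← Complex.exp_nat_mul]
    ring_nf
  simp_rw [h]
  rw [integral_exp_mul_complex hc]
  have h2 : (k : ℂ) * Complex.I * ((2 * Real.pi : ℝ) : ℂ) = k * (2 * Real.pi * Complex.I) := by
    push_cast
    ring
  rw [h2, Complex.exp_nat_mul_two_pi_mul_I]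
  simp

/-- If all the moments of positive order of `Y` vanish, then adding `Y` to an independent random
variable does not change its moments. -/
theorem integral_add_pow_eq_of_indepFun {Ω : Type*} [MeasurableSpace Ω] {μ : Measure Ω}
    [IsProbabilityMeasure μ] {X Y : Ω → ℂ} (hXY : IndepFun X Y μ) {n : ℕ}
    (hX : ∀ k, Integrable (fun ω => X ω ^ k) μ) (hY : ∀ k, Integrable (fun ω => Y ω ^ k) μ)
    (hY0 : ∀ k, k ≠ 0 → ∫ ω, Y ω ^ k ∂μ = 0) :
    ∫ ω, (X ω + Y ω) ^ n ∂μ = ∫ ω, X ω ^ n ∂μ := by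
  have hind (i j : ℕ) : IndepFun (fun ω => X ω ^ i) (fun ω => Y ω ^ j) μ :=
    hXY.comp (φ := fun z => z ^ i) (ψ := fun z => z ^ j) (by fun_prop) (by fun_prop)
  have hint (i : ℕ) : Integrable (fun ω => X ω ^ i * Y ω ^ (n - i) * (n.choose i : ℂ)) μ :=
    ((hind i (n - i)).integrable_mul (hX i) (hY (n - i))).mul_const _
  simp_rw [add_pow]
  rw [integral_finsetSum _ fun i _ => hint i]
  have hterm (i : ℕ) : ∫ ω, X ω ^ i * Y ω ^ (n - i) * (n.choose i : ℂ) ∂μ =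
      (∫ ω, X ω ^ i ∂μ) * (∫ ω, Y ω ^ (n - i) ∂μ) * (n.choose i : ℂ) := by
    rw [integral_mul_const, (hind i (n - i)).integral_fun_mul_eq_mul_integral
      (hX i).aestronglyMeasurable (hY (n - i)).aestronglyMeasurable]
  simp_rw [hterm]
  rw [Finset.sum_range_succ, Finset.sum_eq_zero]
  · simp
  · intro i hi
    rw [hY0 (n - i) (Nat.sub_ne_zero_of_lt (Finset.mem_range.mp hi))]
    simp

/-- If `ξ` is standard real Gaussian and `η` is independent of `ξ` and uniform on the unit
circle, then `ξ + η` has the same (non-conjugated) moments of all orders as `N(0,1)`: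
`E((ξ + η)^n) = E(ξ^n)` for all `n ≥ 1`. -/
theorem gaussian_plus_uniform_circle_moments
    {Ω : Type*} [MeasurableSpace Ω] (μ : Measure Ω) [IsProbabilityMeasure μ]
    (ξ : Ω → ℝ) (η : Ω → ℂ) (hξm : Measurable ξ) (hηm : Measurable η)
    (hξ : Measure.map ξ μ = gaussianReal 0 1)
    (hη : Measure.map η μ =
      Measure.map (fun θ : ℝ => Complex.exp (θ * Complex.I))
        ((ENNReal.ofReal (2 * Real.pi))⁻¹ • volume.restrict (Set.Ico (0 : ℝ) (2 * Real.pi))))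
    (hindep : IndepFun ξ η μ)
    (n : ℕ) (hn : 1 ≤ n) :
    ∫ ω, ((ξ ω : ℂ) + η ω) ^ n ∂μ = ∫ ω, (ξ ω : ℂ) ^ n ∂μ := by
  have hexp : Measurable fun θ : ℝ => Complex.exp (θ * Complex.I) := by fun_prop
  have hnorm : ∀ᵐ ω ∂μ, ‖η ω‖ = 1 := by
    have hmeas : MeasurableSet {z : ℂ | ‖z‖ = 1} := measurableSet_eq_fun (by fun_prop) (by fun_prop)
    refine (ae_map_iff hηm.aemeasurable hmeas).mp ?_
    rw [hη, ae_map_iff hexp.aemeasurable hmeas]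
    exact Eventually.of_forall Complex.norm_exp_ofReal_mul_I
  have hξint (k : ℕ) : Integrable (fun ω => (ξ ω : ℂ) ^ k) μ := by
    have h : Integrable (fun x : ℝ => x ^ k) (Measure.map ξ μ) := by
      rw [hξ]
      refine (integrable_norm_iff (by fun_prop)).mp ?_
      simpa using (memLp_id_gaussianReal (μ := 0) (v := 1) k).integrable_norm_pow'
    simpa using (h.comp_measurable hξm).ofReal (𝕜 := ℂ)
  refine integral_add_pow_eq_of_indepFun (X := fun ω => (ξ ω : ℂ)) (Y := η)
    (hindep.comp Complex.measurable_ofReal measurable_id) hξint (fun k => ?_) fun k hk => ?_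
  · refine Integrable.of_bound (by fun_prop) 1 ?_
    filter_upwards [hnorm] with ω hω
    simp [hω]
  · rw [← integral_map (f := fun z : ℂ => z ^ k) hηm.aemeasurable (by fun_prop), hη,
      integral_map hexp.aemeasurable (by fun_prop), integral_smul_measure,
      setIntegral_Ico_exp_mul_I_pow_eq_zero hk, smul_zero]

end
end
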